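/- arXiv:2206.02258 — 4 statements merged into one kernel-verified Lean document; each statement's English description precedes it below -/
import Mathlib

section
/- Let f : ℝ^d → (0,∞] be a radial decreasing density and suppose there exist 0 < b < ∞ and a constant C ≥ 1 such that f(x) ≤ C f(2x) for all |x| ≤ b. Then for every n ∈ ℕ and every x with |x| ≤ 2b one has f^{n⋆}(x) ≤ n (C‖f‖₁)^{n−1} f(x). -/
open MeasureTheory Filter Topology ENNReal Set

noncomputable section

/-- `iterConv f n` is the `(n+1)`-fold convolution `f^{(n+1)⋆}`. -/
def iterConv {d : ℕ} (f : EuclideanSpace ℝ (Fin d) → ℝ≥0∞) :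
    ℕ → EuclideanSpace ℝ (Fin d) → ℝ≥0∞
  | 0 => f
  | n + 1 => fun x => ∫⁻ y, f (x - y) * iterConv f n y

theorem iterConv_meas {d : ℕ} (f : EuclideanSpace ℝ (Fin d) → ℝ≥0∞) (hf : Measurable f)
    (n : ℕ) : Measurable (iterConv f n) := by
  induction n with
  | zero => exact hf
  | succ n ih =>
    have : Measurable (fun p : EuclideanSpace ℝ (Fin d) × EuclideanSpace ℝ (Fin d) =>
        f (p.1 - p.2) * iterConv f n p.2) :=
      (hf.comp (measurable_fst.sub measurable_snd)).mul (ih.comp measurable_snd)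
    exact this.lintegral_prod_right'

theorem iterConv_mass {d : ℕ} (f : EuclideanSpace ℝ (Fin d) → ℝ≥0∞) (hf : Measurable f)
    (n : ℕ) : ∫⁻ x, iterConv f n x = (∫⁻ x, f x) ^ (n + 1) := by
  induction n with
  | zero => simp [iterConv]
  | succ n ih =>
    have hg := iterConv_meas f hf n
    have : Measurable (fun p : EuclideanSpace ℝ (Fin d) × EuclideanSpace ℝ (Fin d) =>
        f (p.1 - p.2) * iterConv f n p.2) :=
      (hf.comp (measurable_fst.sub measurable_snd)).mul (hg.comp measurable_snd)
    calc ∫⁻ x, iterConv f (n + 1) x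
        = ∫⁻ x, ∫⁻ y, f (x - y) * iterConv f n y := rfl
      _ = ∫⁻ y, ∫⁻ x, f (x - y) * iterConv f n y := lintegral_lintegral_swap this.aemeasurable
      _ = ∫⁻ y, (∫⁻ x, f x) * iterConv f n y := by
          congr 1; ext y
          have hfy : Measurable (fun x => f (x - y)) := hf.comp (measurable_id.sub_const y)
          rw [lintegral_mul_const _ hfy,
            lintegral_sub_right_eq_self f y]
      _ = (∫⁻ x, f x) ^ (n + 1 + 1) := by
          rw [lintegral_const_mul _ hg, ih, pow_succ' _ (n + 1)]

/-- If `f` is a radial decreasing density and `f(x) ≤ C f(2x)` for `|x| ≤ b`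
(where `0 < b < ∞`, `C ≥ 1`), then for every `n ≥ 1` (written `n+1`) and `|x| ≤ 2b`,
`f^{(n+1)⋆}(x) ≤ (n+1) (C‖f‖₁)ⁿ f(x)`. -/
theorem stmt4 (d : ℕ) (hd : 0 < d) (f : EuclideanSpace ℝ (Fin d) → ℝ≥0∞)
    (hmeas : Measurable f) (hpos : ∀ x, 0 < f x) (hint : ∫⁻ x, f x ≠ ⊤)
    (q : ℝ → ℝ≥0∞) (hq : Antitone q) (hfq : ∀ x, f x = q ‖x‖)
    (b : ℝ) (hb : 0 < b) (C : ℝ) (hC : 1 ≤ C)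
    (hCf : ∀ x : EuclideanSpace ℝ (Fin d), ‖x‖ ≤ b → f x ≤ ENNReal.ofReal C * f ((2 : ℝ) • x)) :
    ∀ (n : ℕ) (x : EuclideanSpace ℝ (Fin d)), ‖x‖ ≤ 2 * b →
      iterConv f n x ≤ ((n : ℝ≥0∞) + 1) * (ENNReal.ofReal C * ∫⁻ y, f y) ^ n * f x := by
  have hne : Nonempty (Fin d) := ⟨⟨0, hd⟩⟩
  have hdouble : ∀ r : ℝ, 0 ≤ r → r ≤ 2 * b → q (r / 2) ≤ ENNReal.ofReal C * q r := by
    intro r h0 h1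
    have h := hCf (EuclideanSpace.single ⟨0, hd⟩ (r / 2))
      (by rw [EuclideanSpace.norm_single, Real.norm_of_nonneg (by linarith)]; linarith)
    rw [hfq, hfq, norm_smul, EuclideanSpace.norm_single,
      Real.norm_of_nonneg (show 0 ≤ r / 2 by linarith)] at h
    convert h using 3
    norm_num
    ring
  have hC1 : 1 ≤ ENNReal.ofReal C := by simpa using hC
  have key : ∀ (n : ℕ) (x : EuclideanSpace ℝ (Fin d)),
      iterConv f n x ≤ ((n : ℝ≥0∞) + 1) * (ENNReal.ofReal C * ∫⁻ y, f y) ^ n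
        * q (min ‖x‖ (2 * b)) := by
    intro n
    induction n with
    | zero =>
      intro x
      simp only [iterConv, hfq, Nat.cast_zero, zero_add, pow_zero, one_mul]
      exact hq (min_le_left _ _)
    | succ n ih =>
      intro x
      set r := min ‖x‖ (2 * b) with hr
      have hr0 : 0 ≤ r := le_min (norm_nonneg _) (by linarith)
      have hr1 : r ≤ 2 * b := min_le_right _ _
      have hrx : r ≤ ‖x‖ := min_le_left _ _
      have hD := hdouble r hr0 hr1
      set c := ENNReal.ofReal C with hc
      set I := ∫⁻ y, f y with hI
      have hg := iterConv_meas f hmeas n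
      have hfx : Measurable (fun y => f (x - y)) := hmeas.comp (measurable_const.sub measurable_id)
      have hpt : ∀ y, f (x - y) * iterConv f n y ≤
          (c * q r) * iterConv f n y + f (x - y) * (((n : ℝ≥0∞) + 1) * (c * I) ^ n * (c * q r)) := by
        intro y
        by_cases h : r / 2 ≤ ‖x - y‖
        · refine le_trans ?_ le_self_add
          gcongr
          rw [hfq]
          exact (hq h).trans hD
        · refine le_trans ?_ le_add_self
          gcongr
          refine (ih y).trans ?_
          gcongr
          refine le_trans (hq ?_) hD
          have : ‖x‖ ≤ ‖x - y‖ + ‖y‖ := by simpa using norm_add_le (x - y) y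
          exact le_min (by linarith) (by linarith)
      calc iterConv f (n + 1) x = ∫⁻ y, f (x - y) * iterConv f n y := rfl
        _ ≤ ∫⁻ y, ((c * q r) * iterConv f n y
            + f (x - y) * (((n : ℝ≥0∞) + 1) * (c * I) ^ n * (c * q r))) := lintegral_mono hpt
        _ = (c * q r) * I ^ (n + 1) + I * (((n : ℝ≥0∞) + 1) * (c * I) ^ n * (c * q r)) := by
          rw [lintegral_add_left (hg.const_mul _), lintegral_const_mul _ hg,
            lintegral_mul_const _ hfx, iterConv_mass f hmeas n,
            lintegral_sub_left_eq_self f x]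
        _ ≤ (c ^ (n + 1) * q r) * I ^ (n + 1)
            + I * (((n : ℝ≥0∞) + 1) * (c * I) ^ n * (c * q r)) := by
          gcongr
          exact le_self_pow₀ hC1 (by omega)
        _ = (((n + 1 : ℕ) : ℝ≥0∞) + 1) * (c * I) ^ (n + 1) * q r := by
          push_cast
          ring
  intro n x hx
  have := key n x
  rwa [min_eq_left hx, ← hfq] at this
end
end

section
/- Let f satisfy Assumption (A). If h₂(x) → ∞ as |x| → ∞, or g₂(x) → ∞ as |x| → ∞, then for every n ≥ 2 both h_n(x) → ∞ and g_n(x) → ∞ as |x| → ∞. -/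
open MeasureTheory Filter Topology ENNReal Set

noncomputable section

/-- The set `D(x) = {z : |z| < |x| - 1, |x - z| < |x| - 1}`. -/
def Dset {d : ℕ} (x : EuclideanSpace ℝ (Fin d)) : Set (EuclideanSpace ℝ (Fin d)) :=
  {z | ‖z‖ < ‖x‖ - 1 ∧ ‖x - z‖ < ‖x‖ - 1}

/-- The set `E(x) = {z : |z| < |x|, |x - z| < |x|}`. -/
def Eset {d : ℕ} (x : EuclideanSpace ℝ (Fin d)) : Set (EuclideanSpace ℝ (Fin d)) :=
  {z | ‖z‖ < ‖x‖ ∧ ‖x - z‖ < ‖x‖}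

/-- `hfun f n` is the function `h_{n+1}`. -/
def hfun {d : ℕ} (f : EuclideanSpace ℝ (Fin d) → ℝ≥0∞) :
    ℕ → EuclideanSpace ℝ (Fin d) → ℝ≥0∞
  | 0 => fun _ => 1
  | n + 1 => fun x => (∫⁻ y in Dset x, f (x - y) * f y * hfun f n y) / f x

/-- `gfun f n` is the function `g_{n+1}`. -/
def gfun {d : ℕ} (f : EuclideanSpace ℝ (Fin d) → ℝ≥0∞) :
    ℕ → EuclideanSpace ℝ (Fin d) → ℝ≥0∞
  | 0 => fun _ => 1
  | n + 1 => fun x => (∫⁻ y in Eset x, f (x - y) * f y * gfun f n y) / f x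

/-- The filter "`|x| → ∞`" on `ℝ^d`. -/
def normAtTop (d : ℕ) : Filter (EuclideanSpace ℝ (Fin d)) :=
  Filter.comap (fun x => ‖x‖) Filter.atTop

lemma tendsto_aux {α : Type*} {l : Filter α} {a b : α → ℝ≥0∞} {K : ℝ≥0∞} (hK : K ≠ ⊤)
    (h : ∀ᶠ x in l, a x ≤ 2 * b x + K) (ha : Tendsto a l (𝓝 ⊤)) : Tendsto b l (𝓝 ⊤) := by
  rw [ENNReal.tendsto_nhds_top_iff_nnreal] at ha ⊢
  intro m
  filter_upwards [h, ha (2 * m + K.toNNReal)] with x h1 h2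
  by_contra hb
  push Not at hb
  have h3 : a x ≤ 2 * (m : ℝ≥0∞) + K := h1.trans (by gcongr)
  have h4 : ((2 * m + K.toNNReal : NNReal) : ℝ≥0∞) = 2 * (m : ℝ≥0∞) + K := by
    push_cast
    rw [ENNReal.coe_toNNReal hK]
  rw [h4] at h2
  exact absurd h3 (not_le.mpr h2)

lemma measurableSet_Dset {d : ℕ} (x : EuclideanSpace ℝ (Fin d)) : MeasurableSet (Dset x) := by
  unfold Dset
  have h1 : MeasurableSet {z : EuclideanSpace ℝ (Fin d) | ‖z‖ < ‖x‖ - 1} :=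
    measurableSet_lt (by fun_prop) (by fun_prop)
  have h2 : MeasurableSet {z : EuclideanSpace ℝ (Fin d) | ‖x - z‖ < ‖x‖ - 1} :=
    measurableSet_lt (by fun_prop) (by fun_prop)
  exact h1.inter h2

lemma Dset_subset_Eset {d : ℕ} (x : EuclideanSpace ℝ (Fin d)) : Dset x ⊆ Eset x := by
  rintro z ⟨h1, h2⟩
  exact ⟨by linarith, by linarith⟩

lemma hfun_le_gfun {d : ℕ} (f : EuclideanSpace ℝ (Fin d) → ℝ≥0∞) (n : ℕ) :
    ∀ x, hfun f n x ≤ gfun f n x := by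
  induction n with
  | zero => intro x; exact le_rfl
  | succ n ih =>
    intro x
    simp only [hfun, gfun]
    refine ENNReal.div_le_div_right ?_ _
    refine (lintegral_mono_set (Dset_subset_Eset x)).trans (lintegral_mono fun y => ?_)
    exact mul_le_mul_right (ih y) _

lemma eventually_norm_ge {d : ℕ} (R : ℝ) : ∀ᶠ x in normAtTop d, R ≤ ‖x‖ :=
  tendsto_comap.eventually (eventually_ge_atTop R)

lemma gfun_one_le {d : ℕ} (f : EuclideanSpace ℝ (Fin d) → ℝ≥0∞) (hmeas : Measurable f)
    (C₁ : ℝ)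
    (hC1f : ∀ x y : EuclideanSpace ℝ (Fin d), 1 ≤ ‖x‖ → ‖x‖ ≤ ‖y‖ → ‖y‖ ≤ ‖x‖ + 1 →
      f x ≤ ENNReal.ofReal C₁ * f y) (x : EuclideanSpace ℝ (Fin d)) (hx : 2 ≤ ‖x‖) :
    gfun f 1 x ≤ hfun f 1 x + 2 * (ENNReal.ofReal C₁ * ∫⁻ y, f y) := by
  simp only [hfun, gfun, mul_one]
  set A : Set (EuclideanSpace ℝ (Fin d)) := {z | ‖z‖ < ‖x‖ ∧ ‖x‖ - 1 ≤ ‖z‖} with hA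
  set B : Set (EuclideanSpace ℝ (Fin d)) := {z | ‖x - z‖ < ‖x‖ ∧ ‖x‖ - 1 ≤ ‖x - z‖} with hB
  have hAm : MeasurableSet A := by
    have h1 : MeasurableSet {z : EuclideanSpace ℝ (Fin d) | ‖z‖ < ‖x‖} :=
      measurableSet_lt (by fun_prop) (by fun_prop)
    have h2 : MeasurableSet {z : EuclideanSpace ℝ (Fin d) | ‖x‖ - 1 ≤ ‖z‖} :=
      measurableSet_le (by fun_prop) (by fun_prop)
    exact h1.inter h2
  have hBm : MeasurableSet B := by
    have h1 : MeasurableSet {z : EuclideanSpace ℝ (Fin d) | ‖x - z‖ < ‖x‖} :=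
      measurableSet_lt (by fun_prop) (by fun_prop)
    have h2 : MeasurableSet {z : EuclideanSpace ℝ (Fin d) | ‖x‖ - 1 ≤ ‖x - z‖} :=
      measurableSet_le (by fun_prop) (by fun_prop)
    exact h1.inter h2
  have hsub : Eset x ⊆ Dset x ∪ (A ∪ B) := by
    rintro z ⟨h1, h2⟩
    by_cases h3 : ‖z‖ < ‖x‖ - 1
    · by_cases h4 : ‖x - z‖ < ‖x‖ - 1
      · exact Or.inl ⟨h3, h4⟩
      · exact Or.inr (Or.inr ⟨h2, not_lt.mp h4⟩)
    · exact Or.inr (Or.inl ⟨h1, not_lt.mp h3⟩)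
  have hAi : ∫⁻ y in A, f (x - y) * f y ≤ ENNReal.ofReal C₁ * (∫⁻ y, f y) * f x := by
    calc ∫⁻ y in A, f (x - y) * f y
        ≤ ∫⁻ y in A, (ENNReal.ofReal C₁ * f x) * f (x - y) := by
          refine setLIntegral_mono' hAm fun y hy => ?_
          rw [mul_comm]
          exact mul_le_mul_left (hC1f y x (by linarith [hy.2]) hy.1.le (by linarith [hy.2])) _
      _ ≤ ∫⁻ y, (ENNReal.ofReal C₁ * f x) * f (x - y) := setLIntegral_le_lintegral _ _
      _ = (ENNReal.ofReal C₁ * f x) * ∫⁻ y, f y := by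
          rw [lintegral_const_mul _ (by fun_prop), lintegral_sub_left_eq_self f x]
      _ = _ := by ring
  have hBi : ∫⁻ y in B, f (x - y) * f y ≤ ENNReal.ofReal C₁ * (∫⁻ y, f y) * f x := by
    calc ∫⁻ y in B, f (x - y) * f y
        ≤ ∫⁻ y in B, (ENNReal.ofReal C₁ * f x) * f y := by
          refine setLIntegral_mono' hBm fun y hy => ?_
          exact mul_le_mul_left
            (hC1f (x - y) x (by linarith [hy.2]) hy.1.le (by linarith [hy.2])) _
      _ ≤ ∫⁻ y, (ENNReal.ofReal C₁ * f x) * f y := setLIntegral_le_lintegral _ _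
      _ = (ENNReal.ofReal C₁ * f x) * ∫⁻ y, f y := by
          rw [lintegral_const_mul _ hmeas]
      _ = _ := by ring
  have hall : ∫⁻ y in Eset x, f (x - y) * f y ≤
      (∫⁻ y in Dset x, f (x - y) * f y) + 2 * (ENNReal.ofReal C₁ * (∫⁻ y, f y)) * f x := by
    calc _ ≤ ∫⁻ y in Dset x ∪ (A ∪ B), f (x - y) * f y := lintegral_mono_set hsub
      _ ≤ (∫⁻ y in Dset x, f (x - y) * f y) + ∫⁻ y in A ∪ B, f (x - y) * f y :=
          lintegral_union_le _ _ _
      _ ≤ (∫⁻ y in Dset x, f (x - y) * f y) +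
          ((∫⁻ y in A, f (x - y) * f y) + ∫⁻ y in B, f (x - y) * f y) := by
          gcongr
          exact lintegral_union_le _ _ _
      _ ≤ (∫⁻ y in Dset x, f (x - y) * f y) + (ENNReal.ofReal C₁ * (∫⁻ y, f y) * f x +
            ENNReal.ofReal C₁ * (∫⁻ y, f y) * f x) := by gcongr
      _ = _ := by ring
  refine (ENNReal.div_le_div_right hall _).trans ?_
  rw [ENNReal.add_div]
  gcongr
  exact ENNReal.div_le_of_le_mul le_rfl

lemma hfun_succ_ge {d : ℕ} (f : EuclideanSpace ℝ (Fin d) → ℝ≥0∞)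
    (n : ℕ) (R : ℝ) (hR : ∀ y, R ≤ ‖y‖ → 1 ≤ hfun f n y)
    (x : EuclideanSpace ℝ (Fin d)) (hx : 2 * R ≤ ‖x‖) :
    hfun f 1 x ≤ 2 * hfun f (n + 1) x := by
  simp only [hfun, mul_one]
  rw [← mul_div_assoc]
  refine ENNReal.div_le_div_right ?_ _
  set A : Set (EuclideanSpace ℝ (Fin d)) := {z | z ∈ Dset x ∧ R ≤ ‖z‖} with hA
  set B : Set (EuclideanSpace ℝ (Fin d)) := {z | z ∈ Dset x ∧ R ≤ ‖x - z‖} with hB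
  have hAm : MeasurableSet A := by
    have h2 : MeasurableSet {z : EuclideanSpace ℝ (Fin d) | R ≤ ‖z‖} :=
      measurableSet_le (by fun_prop) (by fun_prop)
    exact (measurableSet_Dset x).inter h2
  have hBm : MeasurableSet B := by
    have h2 : MeasurableSet {z : EuclideanSpace ℝ (Fin d) | R ≤ ‖x - z‖} :=
      measurableSet_le (by fun_prop) (by fun_prop)
    exact (measurableSet_Dset x).inter h2
  have hsub : Dset x ⊆ A ∪ B := by
    intro z hz
    by_cases h : R ≤ ‖z‖
    · exact Or.inl ⟨hz, h⟩
    · refine Or.inr ⟨hz, ?_⟩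
      have := norm_sub_norm_le x z
      push Not at h
      linarith
  have hBA : ∫⁻ y in B, f (x - y) * f y = ∫⁻ y in A, f (x - y) * f y := by
    rw [← lintegral_indicator hBm, ← lintegral_indicator hAm,
      ← lintegral_sub_left_eq_self (A.indicator fun y => f (x - y) * f y) x]
    congr 1
    ext y
    have hiff : y ∈ B ↔ x - y ∈ A := by
      simp only [hA, hB, Dset, mem_ofPred_eq, _root_.sub_sub_cancel]
      tauto
    by_cases hy : y ∈ B
    · rw [indicator_of_mem hy, indicator_of_mem (hiff.mp hy), _root_.sub_sub_cancel, mul_comm]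
    · rw [indicator_of_notMem hy, indicator_of_notMem (fun h => hy (hiff.mpr h))]
  have hAh : ∫⁻ y in A, f (x - y) * f y ≤ ∫⁻ y in Dset x, f (x - y) * f y * hfun f n y := by
    calc _ ≤ ∫⁻ y in A, f (x - y) * f y * hfun f n y := by
          refine setLIntegral_mono' hAm fun y hy => ?_
          exact le_mul_of_one_le_right zero_le (hR y hy.2)
      _ ≤ _ := lintegral_mono_set fun y hy => hy.1
  calc _ ≤ ∫⁻ y in A ∪ B, f (x - y) * f y := lintegral_mono_set hsub
    _ ≤ (∫⁻ y in A, f (x - y) * f y) + ∫⁻ y in B, f (x - y) * f y := lintegral_union_le _ _ _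
    _ = 2 * ∫⁻ y in A, f (x - y) * f y := by rw [hBA, two_mul]
    _ ≤ _ := by gcongr

/-- Under Assumption (A): if `h₂(x) → ∞` or `g₂(x) → ∞` as `|x| → ∞`,
then for every `n ≥ 2` (written `n+2`) both `h_n(x) → ∞` and `g_n(x) → ∞` as `|x| → ∞`. -/
theorem stmt6 (d : ℕ) (hd : 0 < d) (f : EuclideanSpace ℝ (Fin d) → ℝ≥0∞)
    (hmeas : Measurable f) (hpos : ∀ x, 0 < f x) (hint : ∫⁻ x, f x ≠ ⊤)
    (q : ℝ → ℝ≥0∞) (hq : Antitone q) (hfq : ∀ x, f x = q ‖x‖)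
    (C₁ C₂ : ℝ) (hC₁ : 1 ≤ C₁) (hC₂ : 1 ≤ C₂)
    (hC1f : ∀ x y : EuclideanSpace ℝ (Fin d), 1 ≤ ‖x‖ → ‖x‖ ≤ ‖y‖ → ‖y‖ ≤ ‖x‖ + 1 →
      f x ≤ ENNReal.ofReal C₁ * f y)
    (hC2f : ∀ x : EuclideanSpace ℝ (Fin d), ‖x‖ ≤ 1 → f x ≤ ENNReal.ofReal C₂ * f ((2 : ℝ) • x))
    (hyp : Tendsto (hfun f 1) (normAtTop d) (𝓝 ⊤) ∨ Tendsto (gfun f 1) (normAtTop d) (𝓝 ⊤)) :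
    ∀ n : ℕ, Tendsto (hfun f (n + 1)) (normAtTop d) (𝓝 ⊤) ∧
      Tendsto (gfun f (n + 1)) (normAtTop d) (𝓝 ⊤) := by
  have h1 : Tendsto (hfun f 1) (normAtTop d) (𝓝 ⊤) := by
    rcases hyp with h | h
    · exact h
    · refine tendsto_aux (K := 2 * (ENNReal.ofReal C₁ * ∫⁻ y, f y)) ?_ ?_ h
      · exact ENNReal.mul_ne_top (by simp) (ENNReal.mul_ne_top (by simp) hint)
      · filter_upwards [eventually_norm_ge 2] with x hx
        refine (gfun_one_le f hmeas C₁ hC1f x hx).trans ?_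
        gcongr
        exact le_mul_of_one_le_left zero_le (by norm_num)
  have key : ∀ n : ℕ, Tendsto (hfun f (n + 1)) (normAtTop d) (𝓝 ⊤) := by
    intro n
    induction n with
    | zero => exact h1
    | succ n ih =>
      have hev : ∀ᶠ y in normAtTop d, 1 ≤ hfun f (n + 1) y :=
        ih.eventually (eventually_ge_nhds (by simp))
      obtain ⟨R, hR⟩ := eventually_atTop.mp (eventually_comap.mp hev)
      refine tendsto_aux (K := 0) (by simp) ?_ h1
      filter_upwards [eventually_norm_ge (2 * R)] with x hx
      rw [add_zero]
      exact hfun_succ_ge f (n + 1) R (fun y hy => hR _ hy y rfl) x hx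
  intro n
  refine ⟨key n, ?_⟩
  refine tendsto_nhds_top_mono (key n) (Eventually.of_forall fun x => hfun_le_gfun f _ x)
end
end

section
/- Let f satisfy Assumption (A). If h₂(x) → ∞ as |x| → ∞, or g₂(x) → ∞ as |x| → ∞, then for every n ∈ ℕ one has g_n(x)/h_n(x) → 1 as |x| → ∞. -/
open MeasureTheory Filter Topology ENNReal Set

noncomputable section

section helpers

variable {d : ℕ}

lemma ev_iff {p : EuclideanSpace ℝ (Fin d) → Prop} : (∀ᶠ x in normAtTop d, p x) ↔ ∃ R : ℝ, ∀ x, R ≤ ‖x‖ → p x := by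
  unfold normAtTop
  rw [Filter.eventually_comap, Filter.eventually_atTop]
  constructor
  · rintro ⟨R, h⟩
    exact ⟨R, fun x hx => h _ hx x rfl⟩
  · rintro ⟨R, h⟩
    refine ⟨R, fun b hb x hx => h x (by rw [hx]; exact hb)⟩

lemma ev_norm (R : ℝ) : ∀ᶠ x in normAtTop d, R ≤ ‖x‖ := ev_iff.2 ⟨R, fun _ h => h⟩

lemma measSet_D : MeasurableSet {p : EuclideanSpace ℝ (Fin d) × EuclideanSpace ℝ (Fin d) | p.2 ∈ Dset p.1} := by
  have h1 : MeasurableSet {p : EuclideanSpace ℝ (Fin d) × EuclideanSpace ℝ (Fin d) | ‖p.2‖ < ‖p.1‖ - 1} :=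
    measurableSet_lt (by fun_prop) (by fun_prop)
  have h2 : MeasurableSet {p : EuclideanSpace ℝ (Fin d) × EuclideanSpace ℝ (Fin d) | ‖p.1 - p.2‖ < ‖p.1‖ - 1} :=
    measurableSet_lt (by fun_prop) (by fun_prop)
  exact h1.inter h2

lemma measSet_E : MeasurableSet {p : EuclideanSpace ℝ (Fin d) × EuclideanSpace ℝ (Fin d) | p.2 ∈ Eset p.1} := by
  have h1 : MeasurableSet {p : EuclideanSpace ℝ (Fin d) × EuclideanSpace ℝ (Fin d) | ‖p.2‖ < ‖p.1‖} :=
    measurableSet_lt (by fun_prop) (by fun_prop)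
  have h2 : MeasurableSet {p : EuclideanSpace ℝ (Fin d) × EuclideanSpace ℝ (Fin d) | ‖p.1 - p.2‖ < ‖p.1‖} :=
    measurableSet_lt (by fun_prop) (by fun_prop)
  exact h1.inter h2

lemma measD (x : EuclideanSpace ℝ (Fin d)) : MeasurableSet (Dset x) := measurable_prodMk_left measSet_D

lemma measE (x : EuclideanSpace ℝ (Fin d)) : MeasurableSet (Eset x) := measurable_prodMk_left measSet_E

lemma D_sub_E (x : EuclideanSpace ℝ (Fin d)) : Dset x ⊆ Eset x := fun z hz => ⟨by linarith [hz.1], by linarith [hz.2]⟩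

lemma D_symm (x y : EuclideanSpace ℝ (Fin d)) : x - y ∈ Dset x ↔ y ∈ Dset x := by
  simp only [Dset, mem_ofPred_eq, _root_.sub_sub_cancel]
  tauto

lemma meas_param {u : EuclideanSpace ℝ (Fin d) × EuclideanSpace ℝ (Fin d) → ℝ≥0∞} (hu : Measurable u) {S : EuclideanSpace ℝ (Fin d) → Set (EuclideanSpace ℝ (Fin d))}
    (hS : MeasurableSet {p : EuclideanSpace ℝ (Fin d) × EuclideanSpace ℝ (Fin d) | p.2 ∈ S p.1}) :
    Measurable fun x => ∫⁻ y in S x, u (x, y) := by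
  have h := (hu.indicator hS).lintegral_prod_right' (ν := (volume : Measure (EuclideanSpace ℝ (Fin d))))
  convert h using 2 with x
  have hSx : MeasurableSet (S x) := measurable_prodMk_left hS
  rw [← lintegral_indicator hSx]
  rfl

variable {f : EuclideanSpace ℝ (Fin d) → ℝ≥0∞}

lemma measH (hf : Measurable f) (n : ℕ) : Measurable (hfun f n) := by
  induction n with
  | zero => exact measurable_const
  | succ n ih =>
    exact (meas_param (u := fun p : EuclideanSpace ℝ (Fin d) × EuclideanSpace ℝ (Fin d) => f (p.1 - p.2) * f p.2 * hfun f n p.2)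
      (by fun_prop) measSet_D).div hf

lemma measG (hf : Measurable f) (n : ℕ) : Measurable (gfun f n) := by
  induction n with
  | zero => exact measurable_const
  | succ n ih =>
    exact (meas_param (u := fun p : EuclideanSpace ℝ (Fin d) × EuclideanSpace ℝ (Fin d) => f (p.1 - p.2) * f p.2 * gfun f n p.2)
      (by fun_prop) measSet_E).div hf

lemma H_le_G (n : ℕ) (x : EuclideanSpace ℝ (Fin d)) : hfun f n x ≤ gfun f n x := by
  induction n generalizing x with
  | zero => exact le_rfl
  | succ n ih =>
    refine ENNReal.div_le_div_right ?_ _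
    refine (lintegral_mono_set (D_sub_E x)).trans (lintegral_mono fun y => ?_)
    exact mul_le_mul_right (ih y) _

/-- rotation invariance -/
lemma H_rot (hrad : ∀ x y : EuclideanSpace ℝ (Fin d), ‖x‖ = ‖y‖ → f x = f y) (U : EuclideanSpace ℝ (Fin d) ≃ₗᵢ[ℝ] EuclideanSpace ℝ (Fin d)) (n : ℕ) (x : EuclideanSpace ℝ (Fin d)) :
    hfun f n (U x) = hfun f n x := by
  induction n generalizing x with
  | zero => rfl
  | succ n ih =>
    simp only [hfun]
    rw [hrad (U x) x (U.norm_map x)]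
    congr 1
    rw [← lintegral_indicator (measD _), ← lintegral_indicator (measD _),
      ← U.measurePreserving.lintegral_comp_emb U.toMeasurableEquiv.measurableEmbedding]
    refine lintegral_congr fun z => ?_
    have hm : U z ∈ Dset (U x) ↔ z ∈ Dset x := by
      simp only [Dset, mem_ofPred_eq, ← map_sub, U.norm_map]
    by_cases hz : z ∈ Dset x
    · rw [indicator_of_mem hz, indicator_of_mem (hm.2 hz), ih, ← map_sub, hrad _ _ (U.norm_map _), hrad _ _ (U.norm_map z)]
    · rw [indicator_of_notMem hz, indicator_of_notMem (mt hm.1 hz)]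

lemma G_L1 (hf : Measurable f) (hint : ∫⁻ x, f x ≠ ⊤) (n : ℕ) :
    ∫⁻ x, f x * gfun f n x ≠ ⊤ := by
  induction n with
  | zero => simpa [gfun] using hint
  | succ n ih =>
    have hG := measG hf n
    refine ne_top_of_le_ne_top (ENNReal.mul_ne_top hint ih) ?_
    calc ∫⁻ x, f x * gfun f (n+1) x ≤ ∫⁻ x, ∫⁻ y, f (x - y) * f y * gfun f n y := by
          refine lintegral_mono fun x => ?_
          exact ENNReal.mul_div_le.trans (setLIntegral_le_lintegral _ _)
      _ = ∫⁻ y, ∫⁻ x, f (x - y) * f y * gfun f n y := by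
          apply lintegral_lintegral_swap
          apply Measurable.aemeasurable
          unfold Function.uncurry
          fun_prop
      _ = ∫⁻ y, (∫⁻ x, f x) * (f y * gfun f n y) := by
          refine lintegral_congr fun y => ?_
          simp_rw [mul_assoc]
          rw [lintegral_mul_const _ (by fun_prop), lintegral_sub_right_eq_self f y]
      _ = (∫⁻ x, f x) * ∫⁻ y, f y * gfun f n y := lintegral_const_mul _ (by fun_prop)
      _ ≤ _ := le_rfl

open scoped Classical in
/-- Comparison lemma on `D`. -/
lemma lemL (hf : Measurable f) {u v : EuclideanSpace ℝ (Fin d) → ℝ≥0∞} (hv : Measurable v) (c δ B : ℝ≥0∞) (R R' : ℝ)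
    (h1 : ∀ y, R ≤ ‖y‖ → u y ≤ c * v y) (h2 : ∀ y, ‖y‖ < R → u y ≤ B)
    (h3 : ∀ y, R' ≤ ‖y‖ → B ≤ δ * v y) (x : EuclideanSpace ℝ (Fin d)) (hx : R + R' ≤ ‖x‖) :
    ∫⁻ y in Dset x, f (x - y) * f y * u y ≤ (c + δ) * ∫⁻ y in Dset x, f (x - y) * f y * v y := by
  set w : EuclideanSpace ℝ (Fin d) → ℝ≥0∞ := (Dset x).indicator fun y => f (x - y) * f y * v y with hw
  have hwm : Measurable w := Measurable.indicator (by fun_prop) (measD x)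
  set b : EuclideanSpace ℝ (Fin d) → ℝ≥0∞ := fun y => if y ∈ Dset x ∧ ‖y‖ < R then f (x - y) * f y * B else 0 with hb
  have hb1 : ∫⁻ y, b y ≤ δ * ∫⁻ y, w y := by
    rw [← lintegral_sub_left_eq_self b x, ← lintegral_const_mul _ hwm]
    refine lintegral_mono fun y => ?_
    simp only [hb, hw, D_symm, _root_.sub_sub_cancel, indicator]
    split_ifs with ha hc hc
    · have : R' ≤ ‖y‖ := by
        have := norm_sub_norm_le x y
        linarith [ha.2]
      calc f y * f (x - y) * B ≤ f y * f (x - y) * (δ * v y) := by gcongr; exact h3 y this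
        _ = _ := by ring
    · exact absurd ha.1 hc
    · exact zero_le
    · exact zero_le
  rw [← lintegral_indicator (measD _), ← lintegral_indicator (measD _)]
  calc ∫⁻ y, (Dset x).indicator (fun y => f (x - y) * f y * u y) y
      ≤ ∫⁻ y, (c * w y + b y) := by
        refine lintegral_mono fun y => ?_
        simp only [hb, hw, indicator]
        by_cases hy : y ∈ Dset x
        · simp only [hy, if_true, true_and]
          split_ifs with hR
          · refine le_trans ?_ le_add_self
            gcongr
            exact h2 y hR
          · rw [add_zero]
            calc f (x - y) * f y * u y ≤ f (x - y) * f y * (c * v y) := by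
                  gcongr; exact h1 y (not_lt.1 hR)
              _ = _ := by ring
        · simp [hy]
    _ = c * (∫⁻ y, w y) + ∫⁻ y, b y := by
        rw [lintegral_add_left (by fun_prop), lintegral_const_mul _ hwm]
    _ ≤ c * (∫⁻ y, w y) + δ * ∫⁻ y, w y := by gcongr
    _ = _ := by rw [add_mul]

/-- Estimate on `E \ D`. -/
lemma lemED (hf : Measurable f) (hanti : ∀ x y : EuclideanSpace ℝ (Fin d), ‖x‖ ≤ ‖y‖ → f y ≤ f x) (C : ℝ≥0∞)
    (hC1f : ∀ x y : EuclideanSpace ℝ (Fin d), 1 ≤ ‖x‖ → ‖x‖ ≤ ‖y‖ → ‖y‖ ≤ ‖x‖ + 1 → f x ≤ C * f y)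
    {u : EuclideanSpace ℝ (Fin d) → ℝ≥0∞} (hu : Measurable u) (x : EuclideanSpace ℝ (Fin d)) (hx : 2 ≤ ‖x‖) (K : ℝ≥0∞)
    (hK : ∀ y, ‖x‖ - 1 ≤ ‖y‖ → ‖y‖ ≤ ‖x‖ → u y ≤ K) :
    ∫⁻ y in Eset x \ Dset x, f (x - y) * f y * u y
      ≤ C * (∫⁻ y, f y * u y) * f x + C * K * (∫⁻ y, f y) * f x := by
  calc ∫⁻ y in Eset x \ Dset x, f (x - y) * f y * u y
      ≤ ∫⁻ y in Eset x \ Dset x, ((C * f x) * (f y * u y) + (C * K * f x) * f (x - y)) := by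
        refine setLIntegral_mono' ((measE x).diff (measD x)) fun y hy => ?_
        obtain ⟨⟨hy1, hy2⟩, hy3⟩ := hy
        by_cases h : ‖x - y‖ < ‖x‖ - 1
        · have h' : ‖x‖ - 1 ≤ ‖y‖ := by
            by_contra h''
            exact hy3 ⟨not_le.1 h'', h⟩
          refine le_trans ?_ le_add_self
          have e1 := hC1f y x (by linarith) hy1.le (by linarith)
          have e2 := hK y h' hy1.le
          calc f (x - y) * f y * u y ≤ f (x - y) * (C * f x) * K := by gcongr
            _ = _ := by ring
        · rw [not_lt] at h
          refine le_trans ?_ le_self_add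
          have e1 := hC1f (x - y) x (by linarith) hy2.le (by linarith)
          calc f (x - y) * f y * u y ≤ (C * f x) * f y * u y := by gcongr
            _ = _ := by ring
    _ ≤ ∫⁻ y, ((C * f x) * (f y * u y) + (C * K * f x) * f (x - y)) := setLIntegral_le_lintegral _ _
    _ = (C * f x) * (∫⁻ y, f y * u y) + (C * K * f x) * ∫⁻ y, f y := by
        rw [lintegral_add_left (by fun_prop), lintegral_const_mul _ (by fun_prop),
          lintegral_const_mul _ (by fun_prop), lintegral_sub_left_eq_self f x]
    _ = _ := by ring

/-- Regularity of `h_n`. -/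
lemma H_reg (hanti : ∀ x y : EuclideanSpace ℝ (Fin d), ‖x‖ ≤ ‖y‖ → f y ≤ f x) (C : ℝ≥0∞) (hC : 1 ≤ C) (hCt : C ≠ ⊤)
    (hC1f : ∀ x y : EuclideanSpace ℝ (Fin d), 1 ≤ ‖x‖ → ‖x‖ ≤ ‖y‖ → ‖y‖ ≤ ‖x‖ + 1 → f x ≤ C * f y)
    (n : ℕ) (x y : EuclideanSpace ℝ (Fin d)) (hx : 2 ≤ ‖x‖) (hy1 : ‖x‖ - 1 ≤ ‖y‖) (hy2 : ‖y‖ ≤ ‖x‖) :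
    hfun f n y ≤ C * hfun f n x := by
  have hrad : ∀ x y : EuclideanSpace ℝ (Fin d), ‖x‖ = ‖y‖ → f x = f y := fun x y h =>
    le_antisymm (hanti _ _ h.ge) (hanti _ _ h.le)
  cases n with
  | zero => simpa [hfun] using hC
  | succ n =>
    have hx0 : 0 < ‖x‖ := by linarith
    set y' : EuclideanSpace ℝ (Fin d) := (‖y‖ / ‖x‖) • x with hy'
    have hn : ‖y'‖ = ‖y‖ := by
      rw [hy', norm_smul, Real.norm_of_nonneg (by positivity)]
      field_simp
    have hd' : ‖x - y'‖ = ‖x‖ - ‖y‖ := by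
      have : x - y' = (1 - ‖y‖ / ‖x‖) • x := by rw [hy', sub_smul, one_smul]
      rw [this, norm_smul, Real.norm_of_nonneg]
      · field_simp
      · rw [sub_nonneg, div_le_one hx0]; exact hy2
    have hrot : hfun f (n+1) y = hfun f (n+1) y' := by
      rw [← Submodule.reflection_sub hn.symm, H_rot hrad]
    rw [hrot]
    simp only [hfun]
    rw [← mul_div_assoc]
    refine ENNReal.div_le_div ?_ (hanti _ _ (hn.le.trans hy2))
    rw [← lintegral_const_mul' _ _ hCt]
    have hsub : Dset y' ⊆ Dset x := by
      rintro z ⟨hz1, hz2⟩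
      rw [hn] at hz1 hz2
      refine ⟨by linarith, ?_⟩
      have : ‖x - z‖ ≤ ‖x - y'‖ + ‖y' - z‖ := norm_sub_le_norm_sub_add_norm_sub _ _ _
      linarith
    refine le_trans ?_ (lintegral_mono_set hsub)
    refine setLIntegral_mono' (measD _) fun z hz => ?_
    have hz1 := hz.1
    have e1 : 1 ≤ ‖y' - z‖ := by
      have := norm_sub_norm_le y' z
      linarith
    have e2 : ‖x - z‖ ≤ ‖x - y'‖ + ‖y' - z‖ := norm_sub_le_norm_sub_add_norm_sub _ _ _
    have key : f (y' - z) ≤ C * f (x - z) := by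
      rcases le_total ‖y' - z‖ ‖x - z‖ with h | h
      · exact hC1f _ _ e1 h (by linarith)
      · exact (hanti _ _ h).trans (le_mul_of_one_le_left zero_le hC)
    calc f (y' - z) * f z * hfun f n z ≤ C * f (x - z) * f z * hfun f n z := by gcongr
      _ = _ := by ring

lemma G1_bdd (hf : Measurable f) (hd : 0 < d) (hpos : ∀ x, 0 < f x) (hint : ∫⁻ x, f x ≠ ⊤)
    (hanti : ∀ x y : EuclideanSpace ℝ (Fin d), ‖x‖ ≤ ‖y‖ → f y ≤ f x) (hfin : ∀ x : EuclideanSpace ℝ (Fin d), 1 ≤ ‖x‖ → f x ≠ ⊤)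
    (C : ℝ≥0∞) (hCt : C ≠ ⊤)
    (hC2f : ∀ x : EuclideanSpace ℝ (Fin d), ‖x‖ ≤ 1 → f x ≤ C * f ((2 : ℝ) • x)) (R : ℝ) :
    ∃ B : ℝ≥0∞, B ≠ ⊤ ∧ ∀ x : EuclideanSpace ℝ (Fin d), ‖x‖ ≤ R → gfun f 1 x ≤ B := by
  set e : EuclideanSpace ℝ (Fin d) := EuclideanSpace.single ⟨0, hd⟩ 1 with he
  have hen : ‖e‖ = 1 := by simp [he]
  set eR : EuclideanSpace ℝ (Fin d) := EuclideanSpace.single ⟨0, hd⟩ R with heR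
  have heRn : ‖eR‖ = |R| := by simp [heR]
  have hfe : f e ≠ ⊤ := hfin e hen.ge
  have hL : f e / f eR ≠ ⊤ := ENNReal.div_ne_top hfe (hpos _).ne'
  refine ⟨(C + f e / f eR) * (2 * ∫⁻ x, f x), by finiteness, fun x hx => ?_⟩
  have half : ‖(1/2 : ℝ) • x‖ = ‖x‖ / 2 := by
    rw [norm_smul]; norm_num; ring
  have hA : f ((1/2 : ℝ) • x) ≤ (C + f e / f eR) * f x := by
    rcases le_total ‖x‖ 2 with h2 | h2
    · have := hC2f ((1/2 : ℝ) • x) (by rw [half]; linarith)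
      rw [smul_smul] at this
      norm_num at this
      refine le_trans (by norm_num; exact this) ?_
      gcongr
      exact le_self_add
    · have hRx : ‖x‖ ≤ ‖eR‖ := heRn ▸ hx.trans (le_abs_self R)
      have t : f eR ≠ ⊤ := hfin _ (by linarith)
      calc f ((1/2 : ℝ) • x) ≤ f e := hanti _ _ (by rw [half, hen]; linarith)
        _ = f e / f eR * f eR := (ENNReal.div_mul_cancel (hpos _).ne' t).symm
        _ ≤ (C + f e / f eR) * f x := by
          gcongr
          · exact le_add_self
          · exact hanti _ _ hRx
  have hfx : ∫⁻ y in Eset x, f (x - y) * f y * gfun f 0 y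
      ≤ f ((1/2 : ℝ) • x) * (2 * ∫⁻ x, f x) := by
    calc ∫⁻ y in Eset x, f (x - y) * f y * gfun f 0 y
        ≤ ∫⁻ y, f (x - y) * f y * gfun f 0 y := setLIntegral_le_lintegral _ _
      _ ≤ ∫⁻ y, (f ((1/2 : ℝ) • x) * f y + f ((1/2 : ℝ) • x) * f (x - y)) := by
        refine lintegral_mono fun y => ?_
        simp only [gfun, mul_one]
        rcases le_total (‖x‖ / 2) ‖y‖ with h | h
        · refine le_trans ?_ le_add_self
          rw [mul_comm]
          gcongr
          exact hanti _ _ (by rw [half]; exact h)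
        · refine le_trans ?_ le_self_add
          gcongr
          refine hanti _ _ ?_
          have := norm_sub_norm_le x y
          rw [half]; linarith
      _ = _ := by
        rw [lintegral_add_left (by fun_prop), lintegral_const_mul _ (by fun_prop),
          lintegral_const_mul _ (by fun_prop), lintegral_sub_left_eq_self f x]
        ring
  refine ENNReal.div_le_of_le_mul (hfx.trans ?_)
  calc _ ≤ (C + f e / f eR) * f x * (2 * ∫⁻ x, f x) := by gcongr
    _ = _ := by ring

lemma G_bdd (hG1 : ∀ R : ℝ, ∃ B : ℝ≥0∞, B ≠ ⊤ ∧ ∀ x : EuclideanSpace ℝ (Fin d), ‖x‖ ≤ R → gfun f 1 x ≤ B)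
    (n : ℕ) (R : ℝ) :
    ∃ B : ℝ≥0∞, B ≠ ⊤ ∧ ∀ x : EuclideanSpace ℝ (Fin d), ‖x‖ ≤ R → gfun f n x ≤ B := by
  induction n with
  | zero => exact ⟨1, by simp, fun x _ => le_rfl⟩
  | succ n ih =>
    obtain ⟨B, hB, h⟩ := ih
    obtain ⟨B1, hB1, h1⟩ := hG1 R
    refine ⟨B * B1, by finiteness, fun x hx => ?_⟩
    calc gfun f (n+1) x ≤ (B * ∫⁻ y in Eset x, f (x - y) * f y * gfun f 0 y) / f x := by
          refine ENNReal.div_le_div_right ?_ _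
          rw [← lintegral_const_mul' _ _ hB]
          refine setLIntegral_mono' (measE x) fun y hy => ?_
          simp only [gfun, mul_one]
          rw [mul_comm]
          gcongr
          exact h y (hy.1.le.trans hx)
      _ = B * gfun f 1 x := by rw [mul_div_assoc]; rfl
      _ ≤ B * B1 := by gcongr; exact h1 x hx

lemma G_split (n : ℕ) (x : EuclideanSpace ℝ (Fin d)) : ∫⁻ y in Eset x, f (x - y) * f y * gfun f n y ≤
    (∫⁻ y in Dset x, f (x - y) * f y * gfun f n y) +
      ∫⁻ y in Eset x \ Dset x, f (x - y) * f y * gfun f n y := by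
  refine le_trans ?_ (lintegral_union_le _ _ _)
  rw [union_sdiff_cancel (D_sub_E x)]

lemma H_grow (hf : Measurable f)
    (hbd : ∀ (n : ℕ) (R : ℝ), ∃ B : ℝ≥0∞, B ≠ ⊤ ∧ ∀ x : EuclideanSpace ℝ (Fin d), ‖x‖ ≤ R → gfun f n x ≤ B)
    (h1 : Tendsto (hfun f 1) (normAtTop d) (𝓝 ⊤)) (n : ℕ) :
    (∀ᶠ x in normAtTop d, 1 ≤ hfun f n x) ∧
    ∀ M : ℝ≥0∞, M ≠ ⊤ → ∀ᶠ x in normAtTop d, M * hfun f n x ≤ hfun f (n+1) x := by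
  induction n with
  | zero =>
    refine ⟨Eventually.of_forall fun _ => le_rfl, fun M hM => ?_⟩
    filter_upwards [h1.eventually (lt_mem_nhds (lt_top_iff_ne_top.2 hM))] with x hx
    simpa [hfun] using hx.le
  | succ n ih =>
    obtain ⟨ih1, ih2⟩ := ih
    refine ⟨?_, fun M hM => ?_⟩
    · filter_upwards [ih1, ih2 1 (by simp)] with x a b
      rw [one_mul] at b
      exact a.trans b
    · obtain ⟨R, hR⟩ := ev_iff.1 (ih2 (2 * M) (by finiteness))
      obtain ⟨B, hB, hBx⟩ := hbd n R
      have h3 : ∀ᶠ x in normAtTop d, 2 * M * B ≤ 1 * hfun f (n+1) x := by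
        filter_upwards [ih1, ih2 (2 * M * B) (by finiteness)] with x a b
        rw [one_mul]
        exact le_trans (le_mul_of_one_le_right zero_le a) b
      obtain ⟨R', hR'⟩ := ev_iff.1 h3
      refine ev_iff.2 ⟨R + R', fun x hx => ?_⟩
      have := lemL hf (u := fun y => 2 * M * hfun f n y) (measH hf (n+1)) 1 1 (2 * M * B) R R'
        (fun y hy => by rw [one_mul]; exact hR y hy)
        (fun y hy => by
          have := (H_le_G n y).trans (hBx y hy.le)
          gcongr) hR' x hx
      have e : ∫⁻ y in Dset x, f (x - y) * f y * (2 * M * hfun f n y)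
          = 2 * (M * ∫⁻ y in Dset x, f (x - y) * f y * hfun f n y) := by
        rw [← mul_assoc, ← lintegral_const_mul' _ _ (by finiteness)]
        refine lintegral_congr fun y => by ring
      rw [e, one_add_one_eq_two] at this
      have h2 := (ENNReal.mul_le_mul_iff_right (by simp) (by simp)).1 this
      calc M * hfun f (n+1) x = (M * ∫⁻ y in Dset x, f (x - y) * f y * hfun f n y) / f x := by
            rw [mul_div_assoc]; rfl
        _ ≤ _ := ENNReal.div_le_div_right h2 _

lemma main_P (hf : Measurable f) (hpos : ∀ x, 0 < f x) (hint : ∫⁻ x, f x ≠ ⊤)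
    (hanti : ∀ x y : EuclideanSpace ℝ (Fin d), ‖x‖ ≤ ‖y‖ → f y ≤ f x) (hfin : ∀ x : EuclideanSpace ℝ (Fin d), 1 ≤ ‖x‖ → f x ≠ ⊤)
    (C : ℝ≥0∞) (hC : 1 ≤ C) (hCt : C ≠ ⊤)
    (hC1f : ∀ x y : EuclideanSpace ℝ (Fin d), 1 ≤ ‖x‖ → ‖x‖ ≤ ‖y‖ → ‖y‖ ≤ ‖x‖ + 1 → f x ≤ C * f y)
    (hbd : ∀ (n : ℕ) (R : ℝ), ∃ B : ℝ≥0∞, B ≠ ⊤ ∧ ∀ x : EuclideanSpace ℝ (Fin d), ‖x‖ ≤ R → gfun f n x ≤ B)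
    (h1 : Tendsto (hfun f 1) (normAtTop d) (𝓝 ⊤)) (n : ℕ) :
    ∀ ε : ℝ≥0∞, ε ≠ 0 → ε ≠ ⊤ → ∀ᶠ x in normAtTop d, gfun f n x ≤ (1 + ε) * hfun f n x := by
  have grow := H_grow hf hbd h1
  have grow' : ∀ (n : ℕ) (a ε : ℝ≥0∞), a ≠ ⊤ → ε ≠ 0 → ε ≠ ⊤ →
      ∀ᶠ x in normAtTop d, a * hfun f n x ≤ ε * hfun f (n+1) x := by
    intro n a ε ha h0 ht
    filter_upwards [(grow n).2 (a / ε) (ENNReal.div_ne_top ha h0)] with x hx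
    calc a * hfun f n x = ε * (a / ε * hfun f n x) := by
          rw [← mul_assoc, ENNReal.mul_div_cancel h0 ht]
      _ ≤ _ := by gcongr
  induction n with
  | zero =>
    intro ε _ _
    refine Eventually.of_forall fun x => ?_
    simp [gfun, hfun]
  | succ n ih =>
    intro ε h0 ht
    set η := ε / 3 with hη
    have hη0 : η ≠ 0 := by simp [hη, h0]
    have hηt : η ≠ ⊤ := ENNReal.div_ne_top ht (by simp)
    have hη3 : η + η + η = ε := ENNReal.add_thirds ε
    -- part on D
    have hD : ∀ᶠ x in normAtTop d, ∫⁻ y in Dset x, f (x - y) * f y * gfun f n y ≤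
        (1 + η + η) * ∫⁻ y in Dset x, f (x - y) * f y * hfun f n y := by
      cases n with
      | zero =>
        refine Eventually.of_forall fun x => ?_
        refine le_mul_of_one_le_left zero_le ?_
        rw [add_assoc]; exact le_self_add
      | succ n =>
        obtain ⟨R, hR⟩ := ev_iff.1 (ih η hη0 hηt)
        obtain ⟨B, hB, hBx⟩ := hbd (n+1) R
        have h3 : ∀ᶠ x in normAtTop d, B ≤ η * hfun f (n+1) x := by
          filter_upwards [(grow n).1, grow' n B η hB hη0 hηt] with x a b
          exact le_trans (le_mul_of_one_le_right zero_le a) b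
        obtain ⟨R', hR'⟩ := ev_iff.1 h3
        exact ev_iff.2 ⟨R + R', fun x hx => lemL hf (measH hf (n+1)) (1 + η) η B R R' hR
          (fun y hy => hBx y hy.le) hR' x hx⟩
    set J := ∫⁻ y, f y * gfun f n y with hJ
    have hJt : J ≠ ⊤ := G_L1 hf hint n
    set F := ∫⁻ y, f y with hF
    obtain ⟨R, hR⟩ := ev_iff.1 (ih 1 (by simp) (by simp))
    filter_upwards [hD, ev_norm 2, ev_norm (R + 1), (grow n).1,
      grow' n (C * J + C * (2 * C) * F) η (by finiteness) hη0 hηt] with x hxD hx2 hxR hx1 hxg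
    have hfx0 := (hpos x).ne'
    have hfxt := hfin x (by linarith)
    have hED := lemED hf hanti C hC1f (measG hf n) x hx2 (2 * (C * hfun f n x)) (by
      intro y hy1 hy2
      have a := hR y (by linarith)
      rw [one_add_one_eq_two] at a
      refine a.trans ?_
      gcongr
      exact H_reg hanti C hC hCt hC1f n x y hx2 hy1 hy2)
    refine ENNReal.div_le_of_le_mul ((G_split n x).trans ?_)
    have hN : ∫⁻ y in Dset x, f (x - y) * f y * hfun f n y = hfun f (n+1) x * f x :=
      (ENNReal.div_mul_cancel hfx0 hfxt).symm
    rw [hN] at hxD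
    calc _ ≤ (1 + η + η) * (hfun f (n+1) x * f x) + (C * J * f x
            + C * (2 * (C * hfun f n x)) * F * f x) := add_le_add hxD hED
      _ ≤ (1 + η + η) * (hfun f (n+1) x * f x) + (C * J * hfun f n x * f x
            + C * (2 * (C * hfun f n x)) * F * f x) := by
          have : C * J ≤ C * J * hfun f n x := le_mul_of_one_le_right zero_le hx1
          exact add_le_add le_rfl (add_le_add (mul_le_mul_left this _) le_rfl)
      _ = (1 + η + η) * (hfun f (n+1) x * f x)
            + ((C * J + C * (2 * C) * F) * hfun f n x) * f x := by ring
      _ ≤ (1 + η + η) * (hfun f (n+1) x * f x) + (η * hfun f (n+1) x) * f x := by gcongr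
      _ = (1 + (η + η + η)) * hfun f (n+1) x * f x := by ring
      _ = _ := by rw [hη3]

/-- `g₂ → ∞` implies `h₂ → ∞`. -/
lemma H1_of_G1 (hf : Measurable f) (hpos : ∀ x, 0 < f x) (hint : ∫⁻ x, f x ≠ ⊤)
    (hanti : ∀ x y : EuclideanSpace ℝ (Fin d), ‖x‖ ≤ ‖y‖ → f y ≤ f x) (hfin : ∀ x : EuclideanSpace ℝ (Fin d), 1 ≤ ‖x‖ → f x ≠ ⊤)
    (C : ℝ≥0∞) (hCt : C ≠ ⊤)
    (hC1f : ∀ x y : EuclideanSpace ℝ (Fin d), 1 ≤ ‖x‖ → ‖x‖ ≤ ‖y‖ → ‖y‖ ≤ ‖x‖ + 1 → f x ≤ C * f y)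
    (h1 : Tendsto (gfun f 1) (normAtTop d) (𝓝 ⊤)) :
    Tendsto (hfun f 1) (normAtTop d) (𝓝 ⊤) := by
  have hJt := G_L1 hf hint 0
  rw [ENNReal.tendsto_nhds_top_iff_nnreal]
  intro a
  have hKt : C * (∫⁻ y, f y * gfun f 0 y) + C * 1 * (∫⁻ y, f y) ≠ ⊤ := by finiteness
  set K := C * (∫⁻ y, f y * gfun f 0 y) + C * 1 * (∫⁻ y, f y) with hK
  filter_upwards [h1.eventually (lt_mem_nhds (show (a : ℝ≥0∞) + K < ⊤ by
    exact lt_top_iff_ne_top.2 (by finiteness))), ev_norm 2] with x hx hx2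
  have hfx0 := (hpos x).ne'
  have hfxt := hfin x (by linarith)
  have hED := lemED hf hanti C hC1f (measG hf 0) x hx2 1 (fun _ _ _ => le_rfl)
  have : gfun f 1 x ≤ hfun f 1 x + K := by
    refine ENNReal.div_le_of_le_mul ((G_split 0 x).trans ?_)
    have hN : ∫⁻ y in Dset x, f (x - y) * f y * gfun f 0 y = hfun f 1 x * f x :=
      (ENNReal.div_mul_cancel hfx0 hfxt).symm
    rw [hN, add_mul, hK, add_mul]
    gcongr
  exact lt_of_add_lt_add_right (hx.trans_le this)

end helpers

/-- Under Assumption (A): if `h₂(x) → ∞` or `g₂(x) → ∞` as `|x| → ∞`, then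
for every `n ≥ 1` (written `n+1`), `g_{n+1}(x)/h_{n+1}(x) → 1` as `|x| → ∞`.
(Note `g₁/h₁ ≡ 1`, so the indexing covers all `n ∈ ℕ`.) -/
theorem stmt8 (d : ℕ) (hd : 0 < d) (f : EuclideanSpace ℝ (Fin d) → ℝ≥0∞)
    (hmeas : Measurable f) (hpos : ∀ x, 0 < f x) (hint : ∫⁻ x, f x ≠ ⊤)
    (q : ℝ → ℝ≥0∞) (hq : Antitone q) (hfq : ∀ x, f x = q ‖x‖)
    (C₁ C₂ : ℝ) (hC₁ : 1 ≤ C₁) (hC₂ : 1 ≤ C₂)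
    (hC1f : ∀ x y : EuclideanSpace ℝ (Fin d), 1 ≤ ‖x‖ → ‖x‖ ≤ ‖y‖ → ‖y‖ ≤ ‖x‖ + 1 →
      f x ≤ ENNReal.ofReal C₁ * f y)
    (hC2f : ∀ x : EuclideanSpace ℝ (Fin d), ‖x‖ ≤ 1 → f x ≤ ENNReal.ofReal C₂ * f ((2 : ℝ) • x))
    (hyp : Tendsto (hfun f 1) (normAtTop d) (𝓝 ⊤) ∨ Tendsto (gfun f 1) (normAtTop d) (𝓝 ⊤)) :
    ∀ n : ℕ,
      Tendsto (fun x => gfun f n x / hfun f n x) (normAtTop d) (𝓝 1) := by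
  have hanti : ∀ x y : EuclideanSpace ℝ (Fin d), ‖x‖ ≤ ‖y‖ → f y ≤ f x := by
    intro x y h
    rw [hfq, hfq]
    exact hq h
  have hfin : ∀ x : EuclideanSpace ℝ (Fin d), 1 ≤ ‖x‖ → f x ≠ ⊤ := by
    intro x hx
    by_contra hx'
    have hae := ae_lt_top hmeas hint
    have hz : volume (Metric.ball (0 : EuclideanSpace ℝ (Fin d)) 1) = 0 := by
      refine measure_mono_null ?_ (ae_iff.1 hae)
      intro y hy
      have hy' : ‖y‖ < 1 := by simpa using hy
      have := hanti y x (by linarith)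
      rw [hx'] at this
      simpa using this
    exact (Metric.measure_ball_pos volume (0 : EuclideanSpace ℝ (Fin d)) one_pos).ne' hz
  have hC : 1 ≤ ENNReal.ofReal C₁ := by simpa using hC₁
  have hbd := G_bdd (G1_bdd hmeas hd hpos hint hanti hfin _ ENNReal.ofReal_ne_top hC2f)
  have h1 : Tendsto (hfun f 1) (normAtTop d) (𝓝 ⊤) := by
    rcases hyp with h | h
    · exact h
    · exact H1_of_G1 hmeas hpos hint hanti hfin _ ENNReal.ofReal_ne_top hC1f h
  intro n
  rw [ENNReal.tendsto_nhds ENNReal.one_ne_top]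
  intro ε hε
  filter_upwards [main_P hmeas hpos hint hanti hfin _ hC ENNReal.ofReal_ne_top hC1f hbd h1 n
    (min ε 1) (lt_min hε one_pos).ne' (ne_top_of_le_ne_top ENNReal.one_ne_top (min_le_right _ _)),
    (H_grow hmeas hbd h1 n).1] with x hx hx1
  obtain ⟨B, hB, hBx⟩ := hbd n ‖x‖
  have hHt : hfun f n x ≠ ⊤ := ne_top_of_le_ne_top hB ((H_le_G n x).trans (hBx x le_rfl))
  have hH0 : hfun f n x ≠ 0 := (lt_of_lt_of_le one_pos hx1).ne'
  constructor
  · refine tsub_le_self.trans ?_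
    rw [ENNReal.le_div_iff_mul_le (Or.inl hH0) (Or.inl hHt), one_mul]
    exact H_le_G n x
  · refine ENNReal.div_le_of_le_mul (hx.trans ?_)
    gcongr
    exact min_le_left _ _
end
end

section
/- Let f satisfy Assumption (A), set M₁ := f(1,0,…,0)·|B_{1/2}(0)| and M₂ := (C₁ ∨ C₂)·‖f‖₁. If there exists C > 0 such that h₂(x) < C for all x ∈ ℝ^d, then for all |x| ≥ 1: (i) n (M₁/2)^{n−1} f(x) ≤ f^{n⋆}(x) ≤ n (M₂+C)^{n−1} f(x) for every n ∈ ℕ; and (ii) e^{((M₁/2)−‖f‖₁)λ} λ f(x) ≤ p_λ(x) ≤ e^{(M₂+C−‖f‖₁)λ} λ f(x) for every λ > 0. -/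
open MeasureTheory Filter Topology ENNReal Set

noncomputable section

/-- The density `p_λ(x) = e^{-λ‖f‖₁} ∑_{n=1}^∞ λⁿ f^{n⋆}(x)/n!`. -/
def pdens {d : ℕ} (f : EuclideanSpace ℝ (Fin d) → ℝ≥0∞) (lam : ℝ)
    (x : EuclideanSpace ℝ (Fin d)) : ℝ≥0∞ :=
  ENNReal.ofReal (Real.exp (-(lam * (∫⁻ y, f y).toReal))) *
    ∑' n : ℕ, ENNReal.ofReal lam ^ (n + 1) * iterConv f n x / (Nat.factorial (n + 1) : ℝ≥0∞)

lemma iterConv_measurable {d : ℕ} {f : EuclideanSpace ℝ (Fin d) → ℝ≥0∞} (hf : Measurable f)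
    (n : ℕ) : Measurable (iterConv f n) := by
  induction n with
  | zero => exact hf
  | succ n ih =>
    have : Measurable (fun p : EuclideanSpace ℝ (Fin d) × EuclideanSpace ℝ (Fin d) =>
        f (p.1 - p.2) * iterConv f n p.2) :=
      (hf.comp (measurable_fst.sub measurable_snd)).mul (ih.comp measurable_snd)
    exact this.lintegral_prod_right'

lemma lintegral_iterConv {d : ℕ} {f : EuclideanSpace ℝ (Fin d) → ℝ≥0∞} (hf : Measurable f)
    (n : ℕ) : ∫⁻ x, iterConv f n x = (∫⁻ x, f x) ^ (n + 1) := by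
  induction n with
  | zero => simp [iterConv]
  | succ n ih =>
    have hm := iterConv_measurable hf n
    have : Measurable (fun p : EuclideanSpace ℝ (Fin d) × EuclideanSpace ℝ (Fin d) =>
        f (p.1 - p.2) * iterConv f n p.2) :=
      (hf.comp (measurable_fst.sub measurable_snd)).mul (hm.comp measurable_snd)
    simp only [iterConv]
    rw [lintegral_lintegral_swap this.aemeasurable]
    have h : ∀ y, ∫⁻ x, f (x - y) * iterConv f n y = (∫⁻ x, f x) * iterConv f n y := by
      intro y
      have hg : Measurable fun x => f (x - y) := hf.comp (measurable_id.sub_const y)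
      rw [lintegral_mul_const _ hg,
        lintegral_sub_right_eq_self]
    simp_rw [h]
    rw [lintegral_const_mul _ hm, ih, pow_succ' _ (n + 1)]

lemma exp_sum_aux (a lam : ℝ) (ha : 0 ≤ a) (hl : 0 < lam) (b : ℝ≥0∞) :
    ∑' n : ℕ, ENNReal.ofReal lam ^ (n + 1) * (((n : ℝ≥0∞) + 1) * ENNReal.ofReal a ^ n * b) /
      (Nat.factorial (n + 1) : ℝ≥0∞) = ENNReal.ofReal (Real.exp (a * lam) * lam) * b := by
  have hs : HasSum (fun n : ℕ => (a * lam) ^ n / (n.factorial : ℝ)) (Real.exp (a * lam)) := by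
    rw [Real.exp_eq_exp_ℝ]
    exact NormedSpace.expSeries_div_hasSum_exp (a * lam)
  have hs2 := hs.mul_right lam
  rw [← hs2.tsum_eq, ENNReal.ofReal_tsum_of_nonneg (fun n => by positivity) hs2.summable,
    ← ENNReal.tsum_mul_right]
  refine tsum_congr fun n => ?_
  have h1 : ((n : ℝ≥0∞) + 1) = ENNReal.ofReal ((n : ℝ) + 1) := by
    rw [ENNReal.ofReal_add (by positivity) zero_le_one]; simp
  have h2 : ((Nat.factorial (n + 1) : ℕ) : ℝ≥0∞) = ENNReal.ofReal (Nat.factorial (n + 1) : ℝ) := by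
    simp
  have h3 : (a * lam) ^ n / (n.factorial : ℝ) * lam =
      lam ^ (n + 1) * (((n : ℝ) + 1) * a ^ n) / (Nat.factorial (n + 1) : ℝ) := by
    rw [Nat.factorial_succ]; push_cast
    have : (n.factorial : ℝ) ≠ 0 := by positivity
    have : (n : ℝ) + 1 ≠ 0 := by positivity
    field_simp
    ring
  rw [h1, h2, h3, ENNReal.ofReal_div_of_pos (by positivity), ENNReal.ofReal_mul (by positivity),
    ENNReal.ofReal_mul (by positivity), ENNReal.ofReal_pow hl.le, ENNReal.ofReal_pow ha]
  simp only [div_eq_mul_inv]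
  ring

lemma center_aux {d : ℕ} (y : EuclideanSpace ℝ (Fin d)) :
    ∃ c : EuclideanSpace ℝ (Fin d), ∀ z ∈ Metric.ball c (1 / 2), ‖y - z‖ ≤ 1 ∧
      ‖z‖ ≤ max ‖y‖ 1 := by
  have key : ∃ c : EuclideanSpace ℝ (Fin d), ‖y - c‖ ≤ 1 / 2 ∧ ‖c‖ ≤ max ‖y‖ 1 - 1 / 2 := by
    by_cases h : 1 ≤ ‖y‖
    · refine ⟨(1 - 1 / (2 * ‖y‖)) • y, ?_, ?_⟩
      · have : y - (1 - 1 / (2 * ‖y‖)) • y = (1 / (2 * ‖y‖)) • y := by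
          rw [sub_smul, one_smul]; abel
        rw [this, norm_smul, Real.norm_of_nonneg (by positivity)]
        apply le_of_eq
        field_simp
      · have h1 : 1 / (2 * ‖y‖) ≤ 1 := by
          rw [div_le_one (by positivity)]; linarith
        rw [norm_smul, Real.norm_of_nonneg (by linarith), max_eq_left h]
        apply le_of_eq
        field_simp
    · push Not at h
      refine ⟨(1 / 2 : ℝ) • y, ?_, ?_⟩
      · have : y - (1 / 2 : ℝ) • y = (1 / 2 : ℝ) • y := by
          rw [sub_eq_iff_eq_add, ← add_smul]; norm_num
        rw [this, norm_smul, Real.norm_of_nonneg (by positivity)]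
        linarith
      · rw [norm_smul, Real.norm_of_nonneg (by positivity), max_eq_right h.le]
        linarith
  obtain ⟨c, h1, h2⟩ := key
  refine ⟨c, fun z hz => ?_⟩
  rw [mem_ball_iff_norm] at hz
  constructor
  · have : y - z = (y - c) - (z - c) := by abel
    rw [this]
    linarith [norm_sub_le (y - c) (z - c)]
  · have : z = c + (z - c) := by abel
    rw [this]
    linarith [norm_add_le c (z - c)]

lemma lower_aux {d : ℕ} {f : EuclideanSpace ℝ (Fin d) → ℝ≥0∞}
    {q : ℝ → ℝ≥0∞} (hq : Antitone q) (hfq : ∀ x, f x = q ‖x‖) (n : ℕ) :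
    ∀ y, (q 1 * volume (Metric.ball (0 : EuclideanSpace ℝ (Fin d)) (1 / 2))) ^ n *
      q (max ‖y‖ 1) ≤ iterConv f n y := by
  induction n with
  | zero => intro y; simp only [pow_zero, one_mul, iterConv, hfq]; exact hq (le_max_left _ _)
  | succ n ih =>
    intro y
    set M := q 1 * volume (Metric.ball (0 : EuclideanSpace ℝ (Fin d)) (1 / 2)) with hM
    obtain ⟨c, hc⟩ := center_aux y
    calc M ^ (n + 1) * q (max ‖y‖ 1)
        = (q 1 * (M ^ n * q (max ‖y‖ 1))) * volume (Metric.ball c (1 / 2)) := by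
          rw [Measure.addHaar_ball_center, pow_succ, hM]; ring
      _ = ∫⁻ z in Metric.ball c (1 / 2), q 1 * (M ^ n * q (max ‖y‖ 1)) := by
          rw [setLIntegral_const]
      _ ≤ ∫⁻ z in Metric.ball c (1 / 2), f (y - z) * iterConv f n z := by
          refine setLIntegral_mono' Metric.isOpen_ball.measurableSet fun z hz => ?_
          obtain ⟨h1, h2⟩ := hc z hz
          refine mul_le_mul' ?_ ?_
          · rw [hfq]; exact hq h1
          · refine le_trans ?_ (ih z)
            exact mul_le_mul' le_rfl (hq (max_le h2 (le_max_right _ _)))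
      _ ≤ iterConv f (n + 1) y := setLIntegral_le_lintegral _ _

lemma upper_step {d : ℕ} {f : EuclideanSpace ℝ (Fin d) → ℝ≥0∞} (hf : Measurable f)
    {K L C B : ℝ≥0∞} (hK : 1 ≤ K) (hL : ∫⁻ x, f x = L) (n : ℕ)
    (hB : ∀ y, iterConv f n y ≤ B * f y) (x : EuclideanSpace ℝ (Fin d))
    (E : Set (EuclideanSpace ℝ (Fin d))) (hE : MeasurableSet E)
    (hint : ∫⁻ y in E, f (x - y) * f y ≤ C * f x)
    (hcov : ∀ y, y ∉ E → f (x - y) ≤ K * f x ∨ f y ≤ K * f x) :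
    iterConv f (n + 1) x ≤ (K * L ^ (n + 1) + B * (K * L + C)) * f x := by
  have hm := iterConv_measurable hf n
  have hfx : Measurable fun y => f (x - y) := hf.comp (measurable_id.const_sub x)
  have hfm : Measurable fun y => f (x - y) * f y := hfx.mul hf
  have hpt : ∀ y, f (x - y) * iterConv f n y ≤ (K * f x) * iterConv f n y +
      (B * (K * f x) * f (x - y) + B * E.indicator (fun y => f (x - y) * f y) y) := by
    intro y
    by_cases hy : y ∈ E
    · rw [indicator_of_mem hy]
      calc f (x - y) * iterConv f n y ≤ f (x - y) * (B * f y) := mul_le_mul' le_rfl (hB y)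
        _ = B * (f (x - y) * f y) := by ring
        _ ≤ _ := le_add_left le_add_self
    · rcases hcov y hy with h | h
      · exact le_add_right (mul_le_mul' h le_rfl)
      · calc f (x - y) * iterConv f n y ≤ f (x - y) * (B * (K * f x)) :=
              mul_le_mul' le_rfl ((hB y).trans (mul_le_mul' le_rfl h))
          _ = B * (K * f x) * f (x - y) := by ring
          _ ≤ _ := le_add_left le_self_add
  calc iterConv f (n + 1) x = ∫⁻ y, f (x - y) * iterConv f n y := rfl
    _ ≤ _ := lintegral_mono hpt
    _ = (K * f x) * L ^ (n + 1) + (B * (K * f x) * L + B * ∫⁻ y in E, f (x - y) * f y) := by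
        rw [lintegral_add_left (hm.const_mul _), lintegral_const_mul _ hm,
          lintegral_iterConv hf, hL, lintegral_add_left (hfx.const_mul _),
          lintegral_const_mul _ hfx, lintegral_sub_left_eq_self f x, hL,
          lintegral_const_mul _ (hfm.indicator hE), lintegral_indicator hE]
    _ ≤ (K * f x) * L ^ (n + 1) + (B * (K * f x) * L + B * (C * f x)) := by gcongr
    _ = _ := by ring

/-- Under Assumption (A), with `M₁ = f(1,0,…,0)·|B_{1/2}(0)|` and
`M₂ = (C₁ ∨ C₂)·‖f‖₁`: if `h₂(x) < C` for all `x` (`C > 0`), then for all `|x| ≥ 1`: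
(i) `(n+1) (M₁/2)ⁿ f(x) ≤ f^{(n+1)⋆}(x) ≤ (n+1) (M₂+C)ⁿ f(x)` for every `n`; and
(ii) `e^{((M₁/2)-‖f‖₁)λ} λ f(x) ≤ p_λ(x) ≤ e^{(M₂+C-‖f‖₁)λ} λ f(x)` for every `λ > 0`. -/
theorem stmt9 (d : ℕ) (hd : 0 < d) (f : EuclideanSpace ℝ (Fin d) → ℝ≥0∞)
    (hmeas : Measurable f) (hpos : ∀ x, 0 < f x) (hint : ∫⁻ x, f x ≠ ⊤)
    (q : ℝ → ℝ≥0∞) (hq : Antitone q) (hfq : ∀ x, f x = q ‖x‖)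
    (C₁ C₂ : ℝ) (hC₁ : 1 ≤ C₁) (hC₂ : 1 ≤ C₂)
    (hC1f : ∀ x y : EuclideanSpace ℝ (Fin d), 1 ≤ ‖x‖ → ‖x‖ ≤ ‖y‖ → ‖y‖ ≤ ‖x‖ + 1 →
      f x ≤ ENNReal.ofReal C₁ * f y)
    (hC2f : ∀ x : EuclideanSpace ℝ (Fin d), ‖x‖ ≤ 1 → f x ≤ ENNReal.ofReal C₂ * f ((2 : ℝ) • x))
    (M₁ : ℝ≥0∞)
    (hM₁ : M₁ = f (EuclideanSpace.single (⟨0, hd⟩ : Fin d) (1 : ℝ)) *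
      volume (Metric.ball (0 : EuclideanSpace ℝ (Fin d)) (1 / 2)))
    (L : ℝ) (hL : L = (∫⁻ y, f y).toReal)
    (M₂ : ℝ) (hM₂ : M₂ = max C₁ C₂ * L)
    (C : ℝ) (hC : 0 < C) (hh₂ : ∀ x, hfun f 1 x < ENNReal.ofReal C) :
    ∀ x : EuclideanSpace ℝ (Fin d), 1 ≤ ‖x‖ →
      (∀ n : ℕ,
        ((n : ℝ≥0∞) + 1) * (M₁ / 2) ^ n * f x ≤ iterConv f n x ∧
        iterConv f n x ≤ ((n : ℝ≥0∞) + 1) * ENNReal.ofReal (M₂ + C) ^ n * f x) ∧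
      (∀ lam : ℝ, 0 < lam →
        ENNReal.ofReal (Real.exp ((M₁.toReal / 2 - L) * lam) * lam) * f x ≤ pdens f lam x ∧
        pdens f lam x ≤ ENNReal.ofReal (Real.exp ((M₂ + C - L) * lam) * lam) * f x) := by
  subst hM₁
  have hnorm1 : f (EuclideanSpace.single (⟨0, hd⟩ : Fin d) (1 : ℝ)) = q 1 := by
    rw [hfq]; simp
  rw [hnorm1]
  set M := q 1 * volume (Metric.ball (0 : EuclideanSpace ℝ (Fin d)) (1 / 2)) with hM
  have hL0 : 0 ≤ L := hL ▸ ENNReal.toReal_nonneg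
  have hLL : ∫⁻ y, f y = ENNReal.ofReal L := by rw [hL, ENNReal.ofReal_toReal hint]
  set K := ENNReal.ofReal (max C₁ C₂) with hKdef
  have hK1 : 1 ≤ K := by
    rw [hKdef, ENNReal.one_le_ofReal]; exact le_max_of_le_left hC₁
  have hM20 : 0 ≤ M₂ := by
    rw [hM₂]; exact mul_nonneg (le_trans zero_le_one (le_max_of_le_left hC₁)) hL0
  have hM2K : ENNReal.ofReal M₂ = K * ENNReal.ofReal L := by
    rw [hM₂, ENNReal.ofReal_mul (le_trans zero_le_one (le_max_of_le_left hC₁))]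
  have hM2C : ENNReal.ofReal (M₂ + C) = K * ENNReal.ofReal L + ENNReal.ofReal C := by
    rw [ENNReal.ofReal_add hM20 hC.le, hM2K]
  set A := ENNReal.ofReal (M₂ + C) with hA
  -- scaling facts
  have hsc : ∀ x z : EuclideanSpace ℝ (Fin d), 2 < ‖x‖ → ‖x‖ - 1 ≤ ‖z‖ → f z ≤ K * f x := by
    intro x z hx hz
    have hw : ‖((‖x‖ - 1) / ‖x‖) • x‖ = ‖x‖ - 1 := by
      rw [norm_smul, Real.norm_of_nonneg (div_nonneg (by linarith) (by linarith)),
        div_mul_cancel₀ _ (by linarith : ‖x‖ ≠ 0)]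
    calc f z ≤ f (((‖x‖ - 1) / ‖x‖) • x) := by
          rw [hfq, hfq (_ • x), hw]; exact hq hz
      _ ≤ ENNReal.ofReal C₁ * f x := by
          apply hC1f <;> rw [hw] <;> linarith
      _ ≤ K * f x := by
          exact mul_le_mul' (ENNReal.ofReal_le_ofReal (le_max_left _ _)) le_rfl
  have hsc2 : ∀ x z : EuclideanSpace ℝ (Fin d), ‖x‖ ≤ 2 → ‖x‖ / 2 ≤ ‖z‖ → f z ≤ K * f x := by
    intro x z hx hz
    have hw : ‖(1 / 2 : ℝ) • x‖ = ‖x‖ / 2 := by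
      rw [norm_smul, Real.norm_of_nonneg (by norm_num)]; ring
    have h2 : (2 : ℝ) • ((1 / 2 : ℝ) • x) = x := by rw [smul_smul]; norm_num
    calc f z ≤ f ((1 / 2 : ℝ) • x) := by
          rw [hfq, hfq (_ • x), hw]; exact hq hz
      _ ≤ ENNReal.ofReal C₂ * f ((2 : ℝ) • ((1 / 2 : ℝ) • x)) := hC2f _ (by rw [hw]; linarith)
      _ ≤ K * f x := by
          rw [h2]; exact mul_le_mul' (ENNReal.ofReal_le_ofReal (le_max_right _ _)) le_rfl
  have hDm : ∀ x : EuclideanSpace ℝ (Fin d), MeasurableSet (Dset x) := by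
    intro x
    apply IsOpen.measurableSet
    exact (isOpen_lt continuous_norm continuous_const).inter
      (isOpen_lt (continuous_const.sub continuous_id).norm continuous_const)
  have hDint : ∀ x, ∫⁻ y in Dset x, f (x - y) * f y ≤ ENNReal.ofReal C * f x := by
    intro x
    have h := (hh₂ x).le
    simp only [hfun, mul_one] at h
    by_cases hx : f x = ⊤
    · rw [hx, ENNReal.mul_top (by simpa using hC)]; exact le_top
    · rwa [ENNReal.div_le_iff (hpos x).ne' hx] at h
  have hup : ∀ n : ℕ, ∀ x, iterConv f n x ≤ ((n : ℝ≥0∞) + 1) * A ^ n * f x := by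
    intro n
    induction n with
    | zero => intro x; simp [iterConv]
    | succ n ih =>
      intro x
      have hstep : iterConv f (n + 1) x ≤ (K * ENNReal.ofReal L ^ (n + 1) +
          ((n : ℝ≥0∞) + 1) * A ^ n * (K * ENNReal.ofReal L + ENNReal.ofReal C)) * f x := by
        refine upper_step hmeas hK1 hLL n ih x (Dset x) (hDm x) (hDint x) ?_
        intro y hy
        by_cases hx : 2 < ‖x‖
        · by_cases h1 : ‖x‖ - 1 ≤ ‖y‖
          · exact Or.inr (hsc x y hx h1)
          · by_cases h2 : ‖x‖ - 1 ≤ ‖x - y‖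
            · exact Or.inl (hsc x _ hx h2)
            · exact absurd ⟨not_le.1 h1, not_le.1 h2⟩ hy
        · by_cases h1 : ‖x‖ / 2 ≤ ‖y‖
          · exact Or.inr (hsc2 x y (not_lt.1 hx) h1)
          · refine Or.inl (hsc2 x _ (not_lt.1 hx) ?_)
            have := norm_sub_norm_le x y
            linarith
      refine hstep.trans ?_
      rw [← hM2C]
      have hLA : ENNReal.ofReal L ≤ K * ENNReal.ofReal L := le_mul_of_one_le_left' hK1
      have hKA : K * ENNReal.ofReal L ≤ A := by rw [hM2C]; exact le_self_add
      have : K * ENNReal.ofReal L ^ (n + 1) ≤ A ^ (n + 1) := by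
        calc K * ENNReal.ofReal L ^ (n + 1) = ENNReal.ofReal L ^ n * (K * ENNReal.ofReal L) := by
              ring
          _ ≤ A ^ n * A := mul_le_mul' (pow_le_pow_left' (hLA.trans hKA) n) hKA
          _ = A ^ (n + 1) := (pow_succ _ _).symm
      calc _ ≤ (A ^ (n + 1) + ((n : ℝ≥0∞) + 1) * A ^ n * A) * f x := by gcongr
        _ = _ := by push_cast; ring
  have hlow : ∀ n : ℕ, ∀ x, 1 ≤ ‖x‖ → ((n : ℝ≥0∞) + 1) * (M / 2) ^ n * f x ≤ iterConv f n x := by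
    intro n x hx
    have h := lower_aux (d := d) hq hfq n x
    rw [max_eq_left hx, ← hfq, ← hM] at h
    refine le_trans ?_ h
    gcongr
    have h2 : ((n : ℝ≥0∞) + 1) ≤ 2 ^ n := by exact_mod_cast Nat.lt_two_pow_self (n := n)
    calc ((n : ℝ≥0∞) + 1) * (M / 2) ^ n ≤ 2 ^ n * (M / 2) ^ n := by gcongr
      _ = M ^ n := by
        rw [← mul_pow, ENNReal.mul_div_cancel (by norm_num) (by norm_num)]
  intro x hx
  refine ⟨fun n => ⟨hlow n x hx, hup n x⟩, fun lam hlam => ⟨?_, ?_⟩⟩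
  · have e : Real.exp ((M.toReal / 2 - L) * lam) * lam =
        Real.exp (-(lam * L)) * (Real.exp (M.toReal / 2 * lam) * lam) := by
      rw [← mul_assoc, ← Real.exp_add]; congr 2; ring
    rw [e, ENNReal.ofReal_mul (Real.exp_pos _).le, mul_assoc,
      ← exp_sum_aux _ lam (by positivity) hlam, pdens, ← hL]
    gcongr with n
    refine le_trans ?_ (hlow n x hx)
    gcongr
    rw [ENNReal.ofReal_div_of_pos (by norm_num)]
    simp only [ENNReal.ofReal_ofNat]
    gcongr
    exact ENNReal.ofReal_toReal_le
  · have e : Real.exp ((M₂ + C - L) * lam) * lam =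
        Real.exp (-(lam * L)) * (Real.exp ((M₂ + C) * lam) * lam) := by
      rw [← mul_assoc, ← Real.exp_add]; congr 2; ring
    rw [e, ENNReal.ofReal_mul (Real.exp_pos _).le, mul_assoc,
      ← exp_sum_aux _ lam (by positivity) hlam, pdens, ← hL]
    gcongr with n
    exact hup n x
end
end
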